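/- arXiv:1402.7192 — 2 statements merged into one kernel-verified Lean document; each statement's English description precedes it below -/
import Mathlib

section
/- Let 1 ≤ p < q < ∞ and let f be a measurable function on ℝ² whose a.e. sections f_x and f_y belong to Lip(1/p), with φ_{p,1}(y) = ‖f_y‖*_{Lip 1/p} and φ_{p,2}(x) = ‖f_x‖*_{Lip 1/p} in L^{p,1}(ℝ). Define φ_{q,1}(y) = sup_{h>0} h^{−1/q} ‖f(·+h, y) − f(·, y)‖_∞ and φ_{q,2}(x) = sup_{h>0} h^{−1/q} ‖f(x, ·+h) − f(x, ·)‖_∞. Then φ_{q,1}, φ_{q,2} ∈ S₀(ℝ) and for every t > 0, φ_{q,1}*(t) − φ_{q,1}*(2t) ≤ 4 [ φ_{p,1}*(t) + 2 φ_{p,2}*(t/2) ] t^{1/p − 1/q}. -/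
open MeasureTheory Set
open scoped ENNReal

noncomputable section

/-- Extended essential sup norm on ℝ. -/
def einf (φ : ℝ → ℝ) : ℝ≥0∞ := eLpNorm φ ⊤ volume

/-- Lipschitz `α` seminorm (extended real valued):
`sup_{h>0} h^{-α} ‖φ(·+h) - φ‖_∞`. -/
def lipSemiE (α : ℝ) (φ : ℝ → ℝ) : ℝ≥0∞ :=
  ⨆ h ∈ Ioi (0:ℝ), ENNReal.ofReal (h ^ (-α)) * einf (fun x => φ (x + h) - φ x)

/-- Real-valued Lipschitz `α` seminorm `‖φ‖*_{Lip α}`. -/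
def lipSemi (α : ℝ) (φ : ℝ → ℝ) : ℝ := (lipSemiE α φ).toReal

/-- `φ ∈ Lip α`: essentially bounded with finite Lipschitz `α` seminorm. -/
def MemLip (α : ℝ) (φ : ℝ → ℝ) : Prop := einf φ < ⊤ ∧ lipSemiE α φ < ⊤

/-- `‖φ‖_{Lip α} = ‖φ‖_∞ + ‖φ‖*_{Lip α}`. -/
def lipNorm (α : ℝ) (φ : ℝ → ℝ) : ℝ := (einf φ + lipSemiE α φ).toReal

/-- The class `S₀`: measurable functions with finite distribution function at every
positive level. -/
def S0 {X : Type*} [MeasureSpace X] (f : X → ℝ) : Prop :=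
  Measurable f ∧ ∀ s : ℝ, 0 < s → volume {x | s < |f x|} < ⊤

/-- The non-increasing rearrangement `f*`. -/
def rearr {X : Type*} [MeasureSpace X] (f : X → ℝ) (t : ℝ) : ℝ :=
  sInf {s : ℝ | 0 ≤ s ∧ volume {x | s < |f x|} ≤ ENNReal.ofReal t}

/-- `f**(t) = (1/t) ∫₀^t f*(u) du`. -/
def doubleStar {X : Type*} [MeasureSpace X] (f : X → ℝ) (t : ℝ) : ℝ :=
  (∫ u in Ioc (0:ℝ) t, rearr f u) / t

/-- Lorentz `L^{p,q}` norm. -/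
def lorentzNorm {X : Type*} [MeasureSpace X] (p q : ℝ) (f : X → ℝ) : ℝ :=
  (∫ t in Ioi (0:ℝ), (t ^ (1/p) * rearr f t) ^ q / t) ^ (1/q)

/-- Membership in the Lorentz space `L^{p,q}`. -/
def MemLorentz {X : Type*} [MeasureSpace X] (p q : ℝ) (f : X → ℝ) : Prop :=
  S0 f ∧ IntegrableOn (fun t => (t ^ (1/p) * rearr f t) ^ q / t) (Ioi (0:ℝ))

/-- The space `U_p(ℝ²)`: a.e. sections in `Lip (1/p)`, with `Lip (1/p)` norms of the
sections in `L^{p,1}(ℝ)`. -/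
def MemUp (p : ℝ) (f : ℝ × ℝ → ℝ) : Prop :=
  Measurable f ∧
  (∀ᵐ y : ℝ ∂volume, MemLip (1/p) (fun x => f (x, y))) ∧
  (∀ᵐ x : ℝ ∂volume, MemLip (1/p) (fun y => f (x, y))) ∧
  MemLorentz p 1 (fun y => lipNorm (1/p) (fun x => f (x, y))) ∧
  MemLorentz p 1 (fun x => lipNorm (1/p) (fun y => f (x, y)))

/-- The Steklov-type average `f_h`. -/
def avg (f : ℝ × ℝ → ℝ) (h : ℝ) (z : ℝ × ℝ) : ℝ :=
  (∫ u in Ioc (0:ℝ) h, ∫ v in Ioc (0:ℝ) h, f (z.1 + u, z.2 + v)) / h ^ 2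

section Auxiliary

open Filter Topology
open scoped Pointwise

lemma mul_rpow_le_mul_rpow {α c t : ℝ} (hα : α ≤ 1) (hc : 1 ≤ c) (ht : 0 ≤ t) :
    (c * t) ^ α ≤ c * t ^ α := by
  rw [Real.mul_rpow (by linarith) ht]
  exact mul_le_mul_of_nonneg_right (Real.rpow_le_self_of_one_le hc hα) (Real.rpow_nonneg ht _)

lemma einf_le_iff {φ : ℝ → ℝ} {c : ℝ≥0∞} : einf φ ≤ c ↔ ∀ᵐ x, ‖φ x‖ₑ ≤ c := by
  unfold einf
  rw [eLpNorm_exponent_top]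
  exact ⟨fun h => ae_le_eLpNormEssSup.mono fun x hx => hx.trans h,
    eLpNormEssSup_le_of_ae_enorm_bound⟩

lemma enorm_le_ofReal_iff {a r : ℝ} (hr : 0 ≤ r) : ‖a‖ₑ ≤ ENNReal.ofReal r ↔ |a| ≤ r := by
  rw [Real.enorm_eq_ofReal_abs, ENNReal.ofReal_le_ofReal_iff hr]

lemma lipSemiE_le_iff {α : ℝ} {φ : ℝ → ℝ} {c : ℝ≥0∞} :
    lipSemiE α φ ≤ c ↔
      ∀ h : ℝ, 0 < h → einf (fun x => φ (x + h) - φ x) ≤ ENNReal.ofReal (h ^ α) * c := by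
  unfold lipSemiE
  simp only [iSup_le_iff, mem_Ioi]
  refine forall₂_congr fun h hh => ?_
  have h1 : 0 < h ^ α := Real.rpow_pos_of_pos hh _
  rw [Real.rpow_neg hh.le, ENNReal.ofReal_inv_of_pos h1, mul_comm, ← div_eq_mul_inv,
    ENNReal.div_le_iff' (by simpa using h1) ENNReal.ofReal_ne_top]

lemma lipSemi_nonneg (α : ℝ) (φ : ℝ → ℝ) : 0 ≤ lipSemi α φ := ENNReal.toReal_nonneg

lemma einf_sub_le_of_lipSemiE_lt_top {α : ℝ} {φ : ℝ → ℝ} (hφ : lipSemiE α φ < ⊤) {h : ℝ}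
    (hh : 0 < h) :
    einf (fun x => φ (x + h) - φ x) ≤ ENNReal.ofReal (h ^ α * lipSemi α φ) := by
  rw [ENNReal.ofReal_mul (Real.rpow_nonneg hh.le _), lipSemi, ENNReal.ofReal_toReal hφ.ne]
  exact lipSemiE_le_iff.1 le_rfl h hh

lemma lipSemi_le_of_forall_einf_le {α C : ℝ} {φ : ℝ → ℝ} (hC : 0 ≤ C)
    (H : ∀ h : ℝ, 0 < h → einf (fun x => φ (x + h) - φ x) ≤ ENNReal.ofReal (h ^ α * C)) :
    lipSemi α φ ≤ C := by
  refine ENNReal.toReal_le_of_le_ofReal hC (lipSemiE_le_iff.2 fun h hh => ?_)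
  rw [← ENNReal.ofReal_mul (Real.rpow_nonneg hh.le _)]
  exact H h hh

lemma lipSemiE_lt_top_of_memLip {α β : ℝ} (hβ : 0 ≤ β) (hβα : β ≤ α) {φ : ℝ → ℝ}
    (hm : Measurable φ) (hφ : MemLip α φ) : lipSemiE β φ < ⊤ := by
  refine lt_of_le_of_lt (lipSemiE_le_iff.2 fun h hh => ?_ :
    lipSemiE β φ ≤ lipSemiE α φ + (einf φ + einf φ)) (by simp [hφ.1, hφ.2])
  rcases le_total h 1 with h1 | h1
  · refine ((lipSemiE_le_iff (α := α)).1 le_rfl h hh).trans ?_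
    exact mul_le_mul' (ENNReal.ofReal_le_ofReal (Real.rpow_le_rpow_of_exponent_ge hh h1 hβα))
      le_self_add
  · have h2 : (1 : ℝ≥0∞) ≤ ENNReal.ofReal (h ^ β) := by
      rw [ENNReal.one_le_ofReal]
      exact Real.one_le_rpow h1 hβ
    have h3 : einf (fun x => φ (x + h)) = einf φ :=
      eLpNorm_comp_measurePreserving hm.aestronglyMeasurable (measurePreserving_add_right volume h)
    calc einf (fun x => φ (x + h) - φ x) ≤ einf (fun x => φ (x + h)) + einf φ :=
          eLpNorm_sub_le (hm.comp (measurable_add_const h)).aestronglyMeasurable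
            hm.aestronglyMeasurable le_top
      _ ≤ 1 * (lipSemiE α φ + (einf φ + einf φ)) := by
          rw [h3, one_mul]
          exact le_add_self
      _ ≤ _ := by gcongr

lemma eventually_measure_inter_shift_pos {A B : Set ℝ} (hA : MeasurableSet A)
    (hB : MeasurableSet B) {h : ℝ} (hpos : volume (A ∩ (fun x => x + h) ⁻¹' B) ≠ 0) :
    ∀ᶠ k in 𝓝 h, volume (A ∩ (fun x => x + k) ⁻¹' B) ≠ 0 := by
  obtain ⟨K, hKs, hK, hK0⟩ :=
    (hA.inter (measurable_add_const h hB)).exists_lt_isCompact (pos_iff_ne_zero.2 hpos)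
  have ht := (tendsto_measure_vadd_sdiff_isCompact_isClosed (μ := (volume : Measure ℝ)) hK
    hK.isClosed).eventually (gt_mem_nhds hK0)
  have hc : Tendsto (fun k : ℝ => h - k) (𝓝 h) (𝓝 0) := by
    have : Continuous fun k : ℝ => h - k := by fun_prop
    simpa using this.tendsto h
  filter_upwards [hc.eventually ht] with k hk h0
  refine hk.not_ge ?_
  have h1 : volume K = volume ((h - k) +ᵥ K) := (measure_vadd volume (h - k) K).symm
  rw [h1]
  refine (measure_le_inter_add_sdiff volume _ K).trans ?_
  have h2 : volume (((h - k) +ᵥ K) ∩ K) = 0 := by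
    refine measure_mono_null ?_ h0
    rintro x ⟨hx1, hx2⟩
    obtain ⟨z, hz, rfl⟩ := hx1
    refine ⟨(hKs hx2).1, ?_⟩
    have := (hKs hz).2
    simp only [mem_preimage, vadd_eq_add] at this ⊢
    convert this using 1
    ring
  rw [h2, zero_add]

lemma eventually_lt_einf_shift {φ : ℝ → ℝ} (hm : Measurable φ) {h c : ℝ} (hc : 0 ≤ c)
    (H : ENNReal.ofReal c < einf (fun x => φ (x + h) - φ x)) :
    ∀ᶠ k in 𝓝 h, ENNReal.ofReal c < einf (fun x => φ (x + k) - φ x) := by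
  have key : ∀ k, ENNReal.ofReal c < einf (fun x => φ (x + k) - φ x) ↔
      ∃ a : ℚ, volume ({x | φ x < a} ∩ (fun x => x + k) ⁻¹' {x | a + c < φ x}) ≠ 0 ∨
        volume ({x | a + c < φ x} ∩ (fun x => x + k) ⁻¹' {x | φ x < a}) ≠ 0 := by
    intro k
    rw [← not_iff_not, not_lt, einf_le_iff]
    simp only [enorm_le_ofReal_iff hc, not_exists, not_or, not_not]
    constructor
    · intro h a
      constructor
      · refine measure_mono_null ?_ h
        rintro x ⟨h1, h2⟩ h3
        simp only [mem_ofPred_eq, mem_preimage] at h1 h2 h3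
        linarith [(abs_le.1 h3).2]
      · refine measure_mono_null ?_ h
        rintro x ⟨h1, h2⟩ h3
        simp only [mem_ofPred_eq, mem_preimage] at h1 h2 h3
        linarith [(abs_le.1 h3).1]
    · intro h
      have h1 := ae_all_iff.2 fun a => measure_eq_zero_iff_ae_notMem.1 (h a).1
      have h2 := ae_all_iff.2 fun a => measure_eq_zero_iff_ae_notMem.1 (h a).2
      filter_upwards [h1, h2] with x h1 h2
      by_contra! h3
      rcases lt_abs.1 h3 with h3 | h3
      · obtain ⟨a, ha, hb⟩ := exists_rat_btwn (show φ x < φ (x + k) - c by linarith)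
        exact h1 a ⟨ha, by simp only [mem_preimage, mem_ofPred_eq]; linarith⟩
      · obtain ⟨a, ha, hb⟩ := exists_rat_btwn (show φ (x + k) < φ x - c by linarith)
        exact h2 a ⟨by simp only [mem_ofPred_eq]; linarith, ha⟩
  obtain ⟨a, ha⟩ := (key h).1 H
  have hA : MeasurableSet {x | φ x < a} := measurableSet_lt hm measurable_const
  have hB : MeasurableSet {x | a + c < φ x} := measurableSet_lt measurable_const hm
  rcases ha with ha | ha
  · exact (eventually_measure_inter_shift_pos hA hB ha).mono fun k hk => (key k).2 ⟨a, .inl hk⟩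
  · exact (eventually_measure_inter_shift_pos hB hA ha).mono fun k hk => (key k).2 ⟨a, .inr hk⟩

lemma lipSemiE_eq_iSup_rat (α : ℝ) {φ : ℝ → ℝ} (hm : Measurable φ) :
    lipSemiE α φ = ⨆ r : {r : ℚ // 0 < r},
      ENNReal.ofReal ((r : ℝ) ^ (-α)) * einf (fun x => φ (x + (r : ℝ)) - φ x) := by
  apply le_antisymm
  · set C := ⨆ r : {r : ℚ // 0 < r},
      ENNReal.ofReal ((r : ℝ) ^ (-α)) * einf (fun x => φ (x + (r : ℝ)) - φ x) with hC
    rcases eq_or_ne C ⊤ with hCt | hCt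
    · rw [hCt]; exact le_top
    refine lipSemiE_le_iff.2 fun h hh => ?_
    by_contra! hlt
    obtain ⟨s, hs0, hs1, hs2⟩ := ENNReal.lt_iff_exists_real_btwn.1 hlt
    have e1 := eventually_lt_einf_shift hm hs0 hs2
    have e2 : ∀ᶠ k : ℝ in 𝓝 h, ENNReal.ofReal (k ^ α) * C < ENNReal.ofReal s := by
      have ht : Tendsto (fun k : ℝ => ENNReal.ofReal (k ^ α) * C) (𝓝 h)
          (𝓝 (ENNReal.ofReal (h ^ α) * C)) :=
        ENNReal.Tendsto.mul_const (ENNReal.tendsto_ofReal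
          (Real.continuousAt_rpow_const h α (.inl hh.ne'))) (.inr hCt)
      exact ht.eventually (gt_mem_nhds hs1)
    obtain ⟨l, u, ⟨hl, hu⟩, hsub⟩ :=
      mem_nhds_iff_exists_Ioo_subset.1 ((e1.and e2).and (lt_mem_nhds hh))
    obtain ⟨r, hr1, hr2⟩ := exists_rat_btwn (hl.trans hu)
    obtain ⟨⟨h1, h2⟩, h3⟩ := hsub ⟨hr1, hr2⟩
    have h4 : ENNReal.ofReal ((r : ℝ) ^ (-α)) * einf (fun x => φ (x + (r : ℝ)) - φ x) ≤ C :=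
      le_iSup (fun r : {r : ℚ // 0 < r} => ENNReal.ofReal ((r : ℝ) ^ (-α)) *
        einf (fun x => φ (x + (r : ℝ)) - φ x)) ⟨r, by exact_mod_cast h3⟩
    have h5 : 0 < (r : ℝ) ^ α := Real.rpow_pos_of_pos h3 _
    rw [Real.rpow_neg h3.le, ENNReal.ofReal_inv_of_pos h5, mul_comm, ← div_eq_mul_inv,
      ENNReal.div_le_iff' (by simpa using h5) ENNReal.ofReal_ne_top] at h4
    exact absurd (h1.trans_le h4) h2.not_gt
  · refine iSup_le fun r => ?_
    exact le_iSup₂ (f := fun (h : ℝ) (_ : h ∈ Ioi (0 : ℝ)) =>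
      ENNReal.ofReal (h ^ (-α)) * einf (fun x => φ (x + h) - φ x)) ((r : ℚ) : ℝ)
      (by simpa using r.2)

lemma measurable_einf_section {g : ℝ × ℝ → ℝ} (hg : Measurable g) :
    Measurable fun y => einf (fun x => g (x, y)) := by
  refine measurable_of_Iic fun c => ?_
  have : (fun y => einf (fun x => g (x, y))) ⁻¹' Iic c =
      {y | volume ((fun x => (x, y)) ⁻¹' {z : ℝ × ℝ | c < ‖g z‖ₑ}) = 0} := by
    ext y
    simp only [mem_preimage, mem_Iic, einf_le_iff, ae_iff, not_le, mem_ofPred_eq]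
    rfl
  rw [this]
  exact measurable_measure_prodMk_right (measurableSet_lt measurable_const hg.enorm)
    (measurableSet_singleton 0)

lemma measurable_lipSemi_section (α : ℝ) {f : ℝ × ℝ → ℝ} (hf : Measurable f) :
    Measurable fun y => lipSemi α (fun x => f (x, y)) := by
  have h1 : ∀ y, Measurable fun x => f (x, y) := fun y => hf.comp measurable_prodMk_right
  simp only [lipSemi, lipSemiE_eq_iSup_rat α (h1 _)]
  refine Measurable.ennreal_toReal (Measurable.iSup fun r => Measurable.const_mul ?_ _)
  exact measurable_einf_section (g := fun z => f (z.1 + (r : ℝ), z.2) - f z) (by fun_prop)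

lemma ae_ae_of_forall_ae_shift {Q : ℝ → ℝ → Prop} (hQ : MeasurableSet {z : ℝ × ℝ | Q z.1 z.2})
    (h : ∀ k, 0 < k → ∀ᵐ x, Q x (x + k)) : ∀ᵐ x, ∀ᵐ y, x < y → Q x y := by
  have hm : MeasurableSet {z : ℝ × ℝ | 0 < z.1 → Q z.2 (z.2 + z.1)} := by
    have h1 : MeasurableSet {z : ℝ × ℝ | 0 < z.1} := measurableSet_lt measurable_const measurable_fst
    have h2 : MeasurableSet ((fun z : ℝ × ℝ => (z.2, z.2 + z.1)) ⁻¹' {z : ℝ × ℝ | Q z.1 z.2}) :=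
      hQ.preimage (by fun_prop)
    convert h1.compl.union h2 using 1
    ext z
    simp [imp_iff_not_or]
  have h3 : ∀ᵐ k : ℝ, ∀ᵐ x : ℝ, 0 < k → Q x (x + k) := .of_forall fun k => by
    by_cases hk : 0 < k
    · exact (h k hk).mono fun x hx _ => hx
    · exact .of_forall fun x hk' => absurd hk' hk
  filter_upwards [(Measure.ae_ae_comm hm).1 h3] with x hx
  have := (measurePreserving_sub_right volume x).quasiMeasurePreserving.ae hx
  filter_upwards [this] with y hy hxy
  have := hy (sub_pos.2 hxy)
  rwa [add_sub_cancel] at this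

lemma ae_add_left_of_ae {P : ℝ → Prop} (h : ∀ᵐ z, P z) (a : ℝ) : ∀ᵐ u, P (a + u) :=
  (measurePreserving_add_left volume a).quasiMeasurePreserving.ae h

lemma ae_add_right_of_ae {P : ℝ → Prop} (h : ∀ᵐ z, P z) (a : ℝ) : ∀ᵐ u, P (u + a) :=
  (measurePreserving_add_right volume a).quasiMeasurePreserving.ae h

lemma exists_mem_notMem_of_ae {P : ℝ → Prop} {I B : Set ℝ} (h : ∀ᵐ z, P z)
    (hlt : volume B < volume I) : ∃ z ∈ I, z ∉ B ∧ P z := by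
  by_contra! H
  refine hlt.not_ge (measure_mono_ae ?_)
  filter_upwards [h] with z hz hI
  by_contra hB
  exact H z hI hB hz

/-- Regularity of the level `y`: the section is in `Lip α`, and for a.e. higher level `y'` the
sections at `y` and `y'` differ by at most `φ₂(z) (y' - y) ^ α` at a.e. point `z`. -/
def GoodLevel (α : ℝ) (f : ℝ × ℝ → ℝ) (y : ℝ) : Prop :=
  MemLip α (fun x => f (x, y)) ∧
  ∀ᵐ y', y < y' → ∀ᵐ z, |f (z, y') - f (z, y)| ≤ (y' - y) ^ α * lipSemi α (fun v => f (z, v))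

lemma ae_ae_abs_sub_le {α : ℝ} {φ : ℝ → ℝ} (hm : Measurable φ) (hφ : MemLip α φ) :
    ∀ᵐ x, ∀ᵐ x', x < x' → |φ x' - φ x| ≤ (x' - x) ^ α * lipSemi α φ := by
  refine ae_ae_of_forall_ae_shift (Q := fun x x' => |φ x' - φ x| ≤ (x' - x) ^ α * lipSemi α φ)
    (measurableSet_le (by fun_prop) (by fun_prop)) fun k hk => ?_
  have := einf_le_iff.1 (einf_sub_le_of_lipSemiE_lt_top hφ.2 hk)
  filter_upwards [this] with x hx
  rw [enorm_le_ofReal_iff (mul_nonneg (Real.rpow_nonneg hk.le _) (lipSemi_nonneg _ _))] at hx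
  rwa [add_sub_cancel_left]

lemma ae_goodLevel {α : ℝ} {f : ℝ × ℝ → ℝ} (hf : Measurable f)
    (hy : ∀ᵐ y : ℝ ∂volume, MemLip α (fun x => f (x, y)))
    (hx : ∀ᵐ x : ℝ ∂volume, MemLip α (fun y => f (x, y))) :
    ∀ᵐ y, GoodLevel α f y := by
  have hφ : Measurable fun z => lipSemi α (fun v => f (z, v)) :=
    measurable_lipSemi_section α (f := fun z => f z.swap) (hf.comp measurable_swap)
  have h1 : ∀ᵐ z, ∀ᵐ y, ∀ᵐ y', y < y' →
      |f (z, y') - f (z, y)| ≤ (y' - y) ^ α * lipSemi α (fun v => f (z, v)) :=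
    hx.mono fun z hz => ae_ae_abs_sub_le (hf.comp measurable_prodMk_left) hz
  have hm : MeasurableSet {w : (ℝ × ℝ) × ℝ | w.1.2 < w.2 →
      |f (w.1.1, w.2) - f (w.1.1, w.1.2)| ≤
        (w.2 - w.1.2) ^ α * lipSemi α (fun v => f (w.1.1, v))} := by
    have e1 : MeasurableSet {w : (ℝ × ℝ) × ℝ | w.1.2 < w.2} :=
      measurableSet_lt (by fun_prop) (by fun_prop)
    have e2 : MeasurableSet {w : (ℝ × ℝ) × ℝ | |f (w.1.1, w.2) - f (w.1.1, w.1.2)| ≤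
        (w.2 - w.1.2) ^ α * lipSemi α (fun v => f (w.1.1, v))} := by
      refine measurableSet_le (by fun_prop) (Measurable.mul (by fun_prop) ?_)
      exact hφ.comp (measurable_fst.comp measurable_fst)
    convert e1.compl.union e2 using 1
    ext w
    simp [imp_iff_not_or]
  have h2 : ∀ᵐ y, ∀ᵐ z, ∀ᵐ y', y < y' →
      |f (z, y') - f (z, y)| ≤ (y' - y) ^ α * lipSemi α (fun v => f (z, v)) := by
    refine (Measure.ae_ae_comm (p := fun z y => ∀ᵐ y', y < y' →
      |f (z, y') - f (z, y)| ≤ (y' - y) ^ α * lipSemi α (fun v => f (z, v))) ?_).1 h1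
    exact measurable_measure_prodMk_left hm.compl (measurableSet_singleton 0)
  filter_upwards [hy, h2] with y hy1 hy2
  refine ⟨hy1, ?_⟩
  have hm' : MeasurableSet {w : ℝ × ℝ | y < w.2 → |f (w.1, w.2) - f (w.1, y)| ≤
        (w.2 - y) ^ α * lipSemi α (fun v => f (w.1, v))} :=
    hm.preimage (show Measurable fun w : ℝ × ℝ => ((w.1, y), w.2) by fun_prop)
  filter_upwards [(Measure.ae_ae_comm hm').1 hy2] with y' h3 h4
  exact h3.mono fun z hz => hz h4

lemma exists_level_einf_le {p : ℝ} (hp : 1 ≤ p) {f : ℝ × ℝ → ℝ} (hf : Measurable f)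
    (hG : ∀ᵐ y, GoodLevel (1/p) f y) {y₀ t M₁ M₂ : ℝ} (ht : 0 < t) (hM₂ : 0 ≤ M₂)
    (hy₀ : GoodLevel (1/p) f y₀) (hM₁ : lipSemi (1/p) (fun x => f (x, y₀)) ≤ M₁)
    (hE : volume {x | M₂ < |lipSemi (1/p) (fun y => f (x, y))|} ≤ ENNReal.ofReal (t / 2))
    {B : Set ℝ} (hB : volume B ≤ ENNReal.ofReal (2 * t)) :
    ∃ y', GoodLevel (1/p) f y' ∧ y' ∉ B ∧ ∀ h : ℝ, 0 < h →
      einf (fun x => f (x + h, y₀) - f (x, y₀)) ≤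
        ENNReal.ofReal (4 * (M₁ + 2 * M₂) * t ^ (1/p)) +
          einf (fun x => f (x + h, y') - f (x, y')) := by
  have hM₁0 : 0 ≤ M₁ := (lipSemi_nonneg _ _).trans hM₁
  have hα0 : 0 ≤ 1 / p := by positivity
  have hα1 : 1 / p ≤ 1 := by rw [div_le_one (by linarith)]; exact hp
  have hT : 0 ≤ t ^ (1/p) := Real.rpow_nonneg ht.le _
  obtain ⟨y', ⟨hy1, hy2⟩, hyB, hy'G, hy'⟩ :=
    exists_mem_notMem_of_ae (I := Ioo y₀ (y₀ + 4 * t)) (hG.and hy₀.2)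
      (hB.trans_lt (by
        rw [Real.volume_Ioo]
        exact (ENNReal.ofReal_lt_ofReal_iff (by linarith)).2 (by linarith)))
  have hC := hy' hy1
  refine ⟨y', hy'G, hyB, fun h hh => einf_le_iff.2 ?_⟩
  have hA := ae_ae_abs_sub_le (φ := fun x => f (x, y₀)) (hf.comp measurable_prodMk_right) hy₀.1
  have hD := einf_le_iff.1 (le_refl (einf (fun x => f (x + h, y') - f (x, y'))))
  filter_upwards [hA, ae_add_right_of_ae hA h] with x hx1 hx2
  set E := {x | M₂ < |lipSemi (1/p) (fun y => f (x, y))|} with hEdef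
  have hEu : volume ((fun u => x + u) ⁻¹' E ∪ (fun u => x + h + u) ⁻¹' E) <
      volume (Ioo 0 (2 * t)) := by
    refine (measure_union_le _ _).trans_lt ?_
    rw [measure_preimage_add, measure_preimage_add, Real.volume_Ioo]
    refine (add_le_add hE hE).trans_lt ?_
    rw [← ENNReal.ofReal_add (by linarith) (by linarith)]
    exact (ENNReal.ofReal_lt_ofReal_iff (by linarith)).2 (by linarith)
  obtain ⟨u, ⟨hu0, hu1⟩, huE, a1, a2, a3, a4, a5⟩ := exists_mem_notMem_of_ae
    ((ae_add_left_of_ae hx1 x).and ((ae_add_left_of_ae hx2 (x + h)).and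
      ((ae_add_left_of_ae hC x).and ((ae_add_left_of_ae hC (x + h)).and
        (ae_add_left_of_ae hD x))))) hEu
  simp only [hEdef, mem_union, mem_preimage, mem_ofPred_eq, not_or, not_lt] at huE
  have hu : u ^ (1/p) * lipSemi (1/p) (fun x => f (x, y₀)) ≤ 2 * t ^ (1/p) * M₁ := by
    refine mul_le_mul ?_ hM₁ (lipSemi_nonneg _ _) (by positivity)
    exact (Real.rpow_le_rpow hu0.le hu1.le hα0).trans
      (mul_rpow_le_mul_rpow hα1 (by norm_num) ht.le)
  have b1 : |f (x + u, y₀) - f (x, y₀)| ≤ 2 * t ^ (1/p) * M₁ := by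
    refine (a1 (by linarith)).trans ?_
    rwa [add_sub_cancel_left]
  have b2 : |f (x + h + u, y₀) - f (x + h, y₀)| ≤ 2 * t ^ (1/p) * M₁ := by
    refine (a2 (by linarith)).trans ?_
    rwa [add_sub_cancel_left]
  have hlev : (y' - y₀) ^ (1/p) ≤ 4 * t ^ (1/p) :=
    (Real.rpow_le_rpow (by linarith) (by linarith) hα0).trans
      (mul_rpow_le_mul_rpow hα1 (by norm_num) ht.le)
  have b3 : |f (x + u, y') - f (x + u, y₀)| ≤ 4 * t ^ (1/p) * M₂ :=
    a3.trans (mul_le_mul hlev ((le_abs_self _).trans huE.1) (lipSemi_nonneg _ _) (by positivity))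
  have b4 : |f (x + h + u, y') - f (x + h + u, y₀)| ≤ 4 * t ^ (1/p) * M₂ :=
    a4.trans (mul_le_mul hlev ((le_abs_self _).trans huE.2) (lipSemi_nonneg _ _) (by positivity))
  rw [show x + u + h = x + h + u by ring] at a5
  have e : f (x + h, y₀) - f (x, y₀) =
      ((f (x + h, y₀) - f (x, y₀)) - (f (x + h + u, y') - f (x + u, y'))) +
        (f (x + h + u, y') - f (x + u, y')) := by ring
  rw [e]
  refine (enorm_add_le _ _).trans (add_le_add ((enorm_le_ofReal_iff (by positivity)).2 ?_) a5)
  rw [abs_le] at b1 b2 b3 b4 ⊢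
  constructor <;> nlinarith [b1.1, b1.2, b2.1, b2.2, b3.1, b3.2, b4.1, b4.2]

section Rearrangement

variable {X : Type*} [MeasureSpace X] {g : X → ℝ}

lemma rearr_nonneg (g : X → ℝ) (t : ℝ) : 0 ≤ rearr g t := Real.sInf_nonneg fun _ hs => hs.1

lemma rearr_le_of_measure_le {s t : ℝ} (hs : 0 ≤ s)
    (h : volume {x | s < |g x|} ≤ ENNReal.ofReal t) : rearr g t ≤ s :=
  csInf_le ⟨0, fun _ hr => hr.1⟩ ⟨hs, h⟩

lemma exists_measure_lt_le (hg : S0 g) {t : ℝ} (ht : 0 < t) :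
    ∃ s : ℝ, 0 ≤ s ∧ volume {x | s < |g x|} ≤ ENNReal.ofReal t := by
  have hanti : Antitone fun n : ℕ => {x | (n : ℝ) < |g x|} := fun m n hmn x hx =>
    (Nat.cast_le.2 hmn : (m : ℝ) ≤ n).trans_lt hx
  have hlim := tendsto_measure_iInter_atTop (μ := (volume : Measure X))
    (fun n : ℕ => (measurableSet_lt measurable_const hg.1.abs).nullMeasurableSet) hanti
    ⟨1, (hg.2 _ (by norm_num)).ne⟩
  have hempty : ⋂ n : ℕ, {x | (n : ℝ) < |g x|} = ∅ := by
    refine eq_empty_iff_forall_notMem.2 fun x hx => ?_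
    obtain ⟨n, hn⟩ := exists_nat_gt |g x|
    exact lt_asymm hn (mem_iInter.1 hx n)
  rw [hempty, measure_empty] at hlim
  obtain ⟨n, hn⟩ := (hlim.eventually (gt_mem_nhds (ENNReal.ofReal_pos.2 ht))).exists
  exact ⟨n, n.cast_nonneg, hn.le⟩

lemma measure_rearr_lt_le (hg : S0 g) {t : ℝ} (ht : 0 < t) :
    volume {x | rearr g t < |g x|} ≤ ENNReal.ofReal t := by
  have hU : {x | rearr g t < |g x|} =
      ⋃ n : ℕ, {x | rearr g t + 1 / ((n : ℝ) + 1) < |g x|} := by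
    ext x
    simp only [mem_ofPred_eq, mem_iUnion]
    constructor
    · intro h
      obtain ⟨n, hn⟩ := exists_nat_one_div_lt (sub_pos.2 h)
      exact ⟨n, by linarith⟩
    · rintro ⟨n, hn⟩
      have : 0 < 1 / ((n : ℝ) + 1) := Nat.one_div_pos_of_nat
      linarith
  have hmono : Monotone fun n : ℕ => {x | rearr g t + 1 / ((n : ℝ) + 1) < |g x|} := by
    intro m n hmn x hx
    have := Nat.one_div_le_one_div (α := ℝ) hmn
    simp only [mem_ofPred_eq] at hx ⊢
    linarith
  rw [hU, hmono.measure_iUnion]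
  refine iSup_le fun n => ?_
  have hlt : rearr g t < rearr g t + 1 / ((n : ℝ) + 1) :=
    lt_add_of_pos_right _ Nat.one_div_pos_of_nat
  obtain ⟨s, hs, hslt⟩ := exists_lt_of_csInf_lt (exists_measure_lt_le hg ht) hlt
  exact (measure_mono fun x hx => hslt.trans hx).trans hs.2

lemma rearr_anti (hg : S0 g) {s t : ℝ} (hs : 0 < s) (hst : s ≤ t) : rearr g t ≤ rearr g s :=
  rearr_le_of_measure_le (rearr_nonneg g s)
    ((measure_rearr_lt_le hg hs).trans (ENNReal.ofReal_le_ofReal hst))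

lemma MemLorentz.integrableOn {p : ℝ} (hg : MemLorentz p 1 g) :
    IntegrableOn (fun t => t ^ (1/p) * rearr g t / t) (Ioi (0:ℝ)) := by
  simpa using hg.2

lemma MemLorentz.rpow_mul_rearr_le {p : ℝ} (hp : 1 ≤ p) (hg : MemLorentz p 1 g) {t : ℝ}
    (ht : 0 < t) :
    t ^ (1/p) * rearr g t ≤ 4 * ((∫ s in (0:ℝ)..t, s ^ (1/p) * rearr g s / s) -
      ∫ s in (0:ℝ)..(t / 2), s ^ (1/p) * rearr g s / s) := by
  have hα0 : 0 ≤ 1 / p := by positivity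
  have hα1 : 1 / p ≤ 1 := by rw [div_le_one (by linarith)]; exact hp
  have hint : ∀ a b : ℝ, 0 ≤ a → a ≤ b →
      IntervalIntegrable (fun s => s ^ (1/p) * rearr g s / s) volume a b := fun a b ha hab =>
    (intervalIntegrable_iff_integrableOn_Ioc_of_le hab).2
      (hg.integrableOn.mono_set fun x hx => lt_of_le_of_lt ha hx.1)
  rw [intervalIntegral.integral_interval_sub_left (hint 0 t le_rfl ht.le)
    (hint 0 (t/2) le_rfl (by linarith))]
  have hc : ∫ _ in (t/2)..t, (t / 2) ^ (1/p) * rearr g t / t ≤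
      ∫ s in (t/2)..t, s ^ (1/p) * rearr g s / s := by
    refine intervalIntegral.integral_mono_on (by linarith) intervalIntegrable_const
      (hint _ _ (by linarith) (by linarith)) fun s hs => ?_
    have hs0 : 0 < s := by linarith [hs.1]
    have := rearr_nonneg g t
    have h1 : (t / 2) ^ (1/p) ≤ s ^ (1/p) := Real.rpow_le_rpow (by linarith) hs.1 hα0
    have h2 := rearr_anti hg.1 hs0 hs.2
    have h3 : 0 ≤ s ^ (1/p) := Real.rpow_nonneg hs0.le _
    exact div_le_div₀ (mul_nonneg h3 (rearr_nonneg g s))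
      (mul_le_mul h1 h2 this h3) hs0 hs.2
  rw [intervalIntegral.integral_const, smul_eq_mul] at hc
  have h4 : t ^ (1/p) ≤ 2 * (t / 2) ^ (1/p) := by
    simpa [mul_div_cancel₀] using
      mul_rpow_le_mul_rpow (t := t / 2) hα1 one_le_two (by linarith)
  have h5 : (t - t / 2) * ((t / 2) ^ (1/p) * rearr g t / t) = (t / 2) ^ (1/p) * rearr g t / 2 := by
    field_simp
    ring
  have h6 := mul_le_mul_of_nonneg_right h4 (rearr_nonneg g t)
  linarith

lemma MemLorentz.integral_le {p : ℝ} (hg : MemLorentz p 1 g) {t : ℝ} (ht : 0 ≤ t) :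
    ∫ s in (0:ℝ)..t, s ^ (1/p) * rearr g s / s ≤
      ∫ s in Ioi (0:ℝ), s ^ (1/p) * rearr g s / s := by
  rw [intervalIntegral.integral_of_le ht]
  refine setIntegral_mono_set hg.integrableOn ?_ (.of_forall fun s hs => hs.1)
  filter_upwards [ae_restrict_mem measurableSet_Ioi] with s hs
  exact div_nonneg (mul_nonneg (Real.rpow_nonneg (le_of_lt hs) _) (rearr_nonneg g s)) (le_of_lt hs)

end Rearrangement

/-- A bounded potential whose dyadic increments dominate the error made when moving a section to a
nearby regular level. -/
lemma exists_potential {p : ℝ} (hp : 1 ≤ p) {g₁ g₂ : ℝ → ℝ} (h₁ : MemLorentz p 1 g₁)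
    (h₂ : MemLorentz p 1 g₂) :
    ∃ (Φ : ℝ → ℝ) (L : ℝ), (∀ t, 0 < t → Φ t ≤ L) ∧ Tendsto Φ atTop (𝓝 L) ∧
      ∀ t, 0 < t → 4 * (rearr g₁ t + 2 * rearr g₂ (t / 2)) * t ^ (1/p) ≤ Φ (2 * t) - Φ t := by
  have hα1 : 1 / p ≤ 1 := by rw [div_le_one (by linarith)]; exact hp
  set A : (ℝ → ℝ) → ℝ → ℝ := fun g t => ∫ s in (0:ℝ)..t, s ^ (1/p) * rearr g s / s with hA
  set I : (ℝ → ℝ) → ℝ := fun g => ∫ s in Ioi (0:ℝ), s ^ (1/p) * rearr g s / s with hI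
  have hlim : ∀ g, MemLorentz p 1 g → Tendsto (A g) atTop (𝓝 (I g)) := fun g hg =>
    intervalIntegral_tendsto_integral_Ioi 0 hg.integrableOn tendsto_id
  refine ⟨fun t => 16 * A g₁ (t / 2) + 64 * A g₂ (t / 4), 16 * I g₁ + 64 * I g₂, ?_, ?_, ?_⟩
  · intro t ht
    have e1 : A g₁ (t / 2) ≤ I g₁ := h₁.integral_le (by positivity)
    have e2 : A g₂ (t / 4) ≤ I g₂ := h₂.integral_le (by positivity)
    linarith
  · exact (((hlim g₁ h₁).comp (tendsto_id.atTop_div_const (by norm_num))).const_mul 16).add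
      (((hlim g₂ h₂).comp (tendsto_id.atTop_div_const (by norm_num))).const_mul 64)
  · intro t ht
    have e1 : t ^ (1/p) * rearr g₁ t ≤ 4 * (A g₁ t - A g₁ (t / 2)) := h₁.rpow_mul_rearr_le hp ht
    have e2 : (t / 2) ^ (1/p) * rearr g₂ (t / 2) ≤ 4 * (A g₂ (t / 2) - A g₂ (t / 2 / 2)) :=
      h₂.rpow_mul_rearr_le hp (by linarith)
    have h4 : t ^ (1/p) ≤ 2 * (t / 2) ^ (1/p) := by
      simpa [mul_div_cancel₀] using
        mul_rpow_le_mul_rpow (t := t / 2) hα1 one_le_two (by linarith)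
    have h5 := mul_le_mul_of_nonneg_right h4 (rearr_nonneg g₂ (t / 2))
    rw [show t / 2 / 2 = t / 4 by ring] at e2
    simp only
    rw [show 2 * t / 2 = t by ring, show 2 * t / 4 = t / 2 by ring]
    linarith

lemma einf_sub_le_potential {p : ℝ} (hp : 1 ≤ p) {f : ℝ × ℝ → ℝ} (hf : Measurable f)
    (hG : ∀ᵐ y, GoodLevel (1/p) f y)
    (h₁ : S0 (fun y => lipSemi (1/p) (fun x => f (x, y))))
    (h₂ : S0 (fun x => lipSemi (1/p) (fun y => f (x, y)))) {Φ : ℝ → ℝ}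
    (hΦ : ∀ t, 0 < t → 4 * (rearr (fun y => lipSemi (1/p) (fun x => f (x, y))) t +
      2 * rearr (fun x => lipSemi (1/p) (fun y => f (x, y))) (t / 2)) * t ^ (1/p) ≤
        Φ (2 * t) - Φ t) (n : ℕ) {t y₀ : ℝ} (ht : 0 < t) (hy₀ : GoodLevel (1/p) f y₀)
    (hle : lipSemi (1/p) (fun x => f (x, y₀)) ≤
      rearr (fun y => lipSemi (1/p) (fun x => f (x, y))) t) {h : ℝ} (hh : 0 < h) :
    einf (fun x => f (x + h, y₀) - f (x, y₀)) ≤ ENNReal.ofReal (Φ (2 ^ n * t) - Φ t) +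
      ENNReal.ofReal (h ^ (1/p) * rearr (fun y => lipSemi (1/p) (fun x => f (x, y))) (2 ^ n * t)) := by
  induction n generalizing t y₀ with
  | zero =>
    simp only [pow_zero, one_mul, sub_self, ENNReal.ofReal_zero, zero_add]
    refine (einf_sub_le_of_lipSemiE_lt_top hy₀.1.2 hh).trans (ENNReal.ofReal_le_ofReal ?_)
    exact mul_le_mul_of_nonneg_left hle (Real.rpow_nonneg hh.le _)
  | succ n ih =>
    obtain ⟨y', hy'G, hy'B, hy'⟩ := exists_level_einf_le hp hf hG ht (rearr_nonneg _ _) hy₀ hle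
      (measure_rearr_lt_le h₂ (half_pos ht))
      (measure_rearr_lt_le h₁ (show 0 < 2 * t by linarith))
    have h3 := ih (show 0 < 2 * t by linarith) hy'G ((le_abs_self _).trans (not_lt.1 hy'B))
    rw [show (2:ℝ) ^ n * (2 * t) = 2 ^ (n + 1) * t by ring] at h3
    have hnn : ∀ s, 0 < s → Φ s ≤ Φ (2 * s) := fun s hs => by
      have e1 := rearr_nonneg (fun y => lipSemi (1/p) (fun x => f (x, y))) s
      have e2 := rearr_nonneg (fun x => lipSemi (1/p) (fun y => f (x, y))) (s / 2)
      have := hΦ s hs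
      have : 0 ≤ 4 * (rearr (fun y => lipSemi (1/p) (fun x => f (x, y))) s +
        2 * rearr (fun x => lipSemi (1/p) (fun y => f (x, y))) (s / 2)) * s ^ (1/p) := by positivity
      linarith
    have hmono : ∀ m : ℕ, Φ (2 * t) ≤ Φ (2 ^ (m + 1) * t) := fun m => by
      induction m with
      | zero => simp
      | succ m hm =>
        refine hm.trans ((hnn _ (by positivity)).trans_eq ?_)
        ring_nf
    refine (hy' h hh).trans ((add_le_add (ENNReal.ofReal_le_ofReal (hΦ t ht)) h3).trans_eq ?_)
    rw [← add_assoc, ← ENNReal.ofReal_add (sub_nonneg.2 (hnn t ht)) (sub_nonneg.2 (hmono n))]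
    congr 2
    ring

lemma S0_lipSemi_section {p q : ℝ} (hp : 1 ≤ p) (hpq : p < q) {f : ℝ × ℝ → ℝ} (hf : Measurable f)
    (hG : ∀ᵐ y, GoodLevel (1/p) f y)
    (h₁ : MemLorentz p 1 (fun y => lipSemi (1/p) (fun x => f (x, y))))
    (h₂ : MemLorentz p 1 (fun x => lipSemi (1/p) (fun y => f (x, y)))) :
    S0 (fun y => lipSemi (1/q) (fun x => f (x, y))) := by
  refine ⟨measurable_lipSemi_section _ hf, fun s hs => ?_⟩
  obtain ⟨Φ, L, hL, hlim, hΦ⟩ := exists_potential hp h₁ h₂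
  have hq0 : 0 ≤ 1 / q := one_div_nonneg.2 (by linarith)
  have hqp : 1 / q ≤ 1 / p := one_div_le_one_div_of_le (by linarith) hpq.le
  set φ := fun y => lipSemi (1/p) (fun x => f (x, y)) with hφ
  have hφle : ∀ t, 1 ≤ t → rearr φ t ≤ L - Φ t := fun t ht => by
    have e1 := rearr_nonneg φ t
    have e2 := rearr_nonneg (fun x => lipSemi (1/p) (fun y => f (x, y))) (t / 2)
    have e3 : 1 ≤ t ^ (1/p) := Real.one_le_rpow ht (hq0.trans hqp)
    have e4 := hΦ t (by linarith)
    have e5 := hL (2 * t) (by linarith)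
    have e6 : rearr φ t ≤ 4 * (rearr φ t +
      2 * rearr (fun x => lipSemi (1/p) (fun y => f (x, y))) (t / 2)) * t ^ (1/p) := by
      nlinarith
    linarith
  obtain ⟨t, hts, ht1⟩ := ((hlim.eventually (lt_mem_nhds (sub_lt_self L hs))).and
    (eventually_ge_atTop 1)).exists
  have ht : 0 < t := by linarith
  refine lt_of_le_of_lt (measure_mono_ae ?_) ((measure_rearr_lt_le h₁.1 ht).trans_lt
    ENNReal.ofReal_lt_top)
  filter_upwards [hG] with y hyG hys
  by_contra hle
  have hle : φ y ≤ rearr φ t := (le_abs_self _).trans (not_lt.1 hle)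
  refine absurd hys (not_lt.2 ?_)
  rw [abs_of_nonneg (lipSemi_nonneg _ _)]
  refine lipSemi_le_of_forall_einf_le hs.le fun h hh => ?_
  rcases le_total h 1 with h1 | h1
  · refine (einf_sub_le_of_lipSemiE_lt_top hyG.1.2 hh).trans (ENNReal.ofReal_le_ofReal ?_)
    refine mul_le_mul (Real.rpow_le_rpow_of_exponent_ge hh h1 hqp) ?_ (lipSemi_nonneg _ _)
      (Real.rpow_nonneg hh.le _)
    linarith [hφle t ht1]
  · have hbound : einf (fun x => f (x + h, y) - f (x, y)) ≤ ENNReal.ofReal s := by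
      have hpow : Tendsto (fun n : ℕ => (2:ℝ) ^ n * t) atTop atTop :=
        (tendsto_pow_atTop_atTop_of_one_lt (by norm_num)).atTop_mul_const ht
      have hz : Tendsto (fun n : ℕ => rearr φ (2 ^ n * t)) atTop (𝓝 0) := by
        refine squeeze_zero (fun n => rearr_nonneg _ _) (fun n => hφle _ ?_)
          (by simpa using (hlim.comp hpow).const_sub L)
        exact one_le_mul_of_one_le_of_one_le (one_le_pow₀ (by norm_num)) ht1
      have hz' : Tendsto (fun n : ℕ => ENNReal.ofReal s +
          ENNReal.ofReal (h ^ (1/p) * rearr φ (2 ^ n * t))) atTop (𝓝 (ENNReal.ofReal s)) := by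
        simpa using (ENNReal.tendsto_ofReal (hz.const_mul (h ^ (1/p)))).const_add
          (ENNReal.ofReal s)
      refine ge_of_tendsto' hz' fun n => ?_
      refine (einf_sub_le_potential hp hf hG h₁.1 h₂.1 hΦ n ht hyG hle hh).trans ?_
      gcongr
      linarith [hL (2 ^ n * t) (by positivity)]
    refine hbound.trans (ENNReal.ofReal_le_ofReal ?_)
    exact le_mul_of_one_le_left hs.le (Real.one_le_rpow h1 hq0)

lemma rearr_lipSemi_section_le {p q : ℝ} (hp : 1 ≤ p) (hpq : p < q) {f : ℝ × ℝ → ℝ}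
    (hf : Measurable f) (hG : ∀ᵐ y, GoodLevel (1/p) f y)
    (h₁ : S0 (fun y => lipSemi (1/p) (fun x => f (x, y))))
    (h₂ : S0 (fun x => lipSemi (1/p) (fun y => f (x, y))))
    (hq : S0 (fun y => lipSemi (1/q) (fun x => f (x, y)))) {t : ℝ} (ht : 0 < t) :
    rearr (fun y => lipSemi (1/q) (fun x => f (x, y))) t ≤
      4 * (rearr (fun y => lipSemi (1/p) (fun x => f (x, y))) t +
        2 * rearr (fun x => lipSemi (1/p) (fun y => f (x, y))) (t / 2)) * t ^ (1/p - 1/q) +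
      rearr (fun y => lipSemi (1/q) (fun x => f (x, y))) (2 * t) := by
  have hq0 : 0 ≤ 1 / q := one_div_nonneg.2 (by linarith)
  have hqp : 1 / q ≤ 1 / p := one_div_le_one_div_of_le (by linarith) hpq.le
  have hr1 := rearr_nonneg (fun y => lipSemi (1/p) (fun x => f (x, y))) t
  have hr2 := rearr_nonneg (fun x => lipSemi (1/p) (fun y => f (x, y))) (t / 2)
  have hr3 := rearr_nonneg (fun y => lipSemi (1/q) (fun x => f (x, y))) (2 * t)
  have hT : 0 < t ^ (1/p - 1/q) := Real.rpow_pos_of_pos ht _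
  refine rearr_le_of_measure_le (by positivity) ?_
  refine (measure_mono_ae ?_).trans (measure_rearr_lt_le h₁ ht)
  filter_upwards [hG] with y hyG hys
  by_contra hle
  have hle : lipSemi (1/p) (fun x => f (x, y)) ≤
    rearr (fun y => lipSemi (1/p) (fun x => f (x, y))) t := (le_abs_self _).trans (not_lt.1 hle)
  refine absurd hys (not_lt.2 ?_)
  rw [abs_of_nonneg (lipSemi_nonneg _ _)]
  obtain ⟨y', hy'G, hy'B, hy'⟩ := exists_level_einf_le hp hf hG ht hr2 hyG hle
    (measure_rearr_lt_le h₂ (half_pos ht)) (measure_rearr_lt_le hq (show 0 < 2 * t by linarith))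
  have hy'le : lipSemi (1/q) (fun x => f (x, y')) ≤
    rearr (fun y => lipSemi (1/q) (fun x => f (x, y))) (2 * t) :=
      (le_abs_self _).trans (not_lt.1 hy'B)
  refine lipSemi_le_of_forall_einf_le (by positivity) fun h hh => ?_
  have hhq : 0 < h ^ (1/q) := Real.rpow_pos_of_pos hh _
  rcases le_total h t with h1 | h1
  · refine (einf_sub_le_of_lipSemiE_lt_top hyG.1.2 hh).trans (ENNReal.ofReal_le_ofReal ?_)
    have e1 : h ^ (1/p) = h ^ (1/q) * h ^ (1/p - 1/q) := by
      rw [← Real.rpow_add hh]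
      ring_nf
    rw [e1, mul_assoc]
    refine mul_le_mul_of_nonneg_left ?_ hhq.le
    have e2 : h ^ (1/p - 1/q) ≤ t ^ (1/p - 1/q) :=
      Real.rpow_le_rpow hh.le h1 (sub_nonneg.2 hqp)
    have e3 := mul_le_mul e2 hle (lipSemi_nonneg _ _) hT.le
    nlinarith [mul_nonneg hr1 hT.le, mul_nonneg hr2 hT.le]
  · have hlt : lipSemiE (1/q) (fun x => f (x, y')) < ⊤ :=
      lipSemiE_lt_top_of_memLip hq0 hqp (hf.comp measurable_prodMk_right) hy'G.1
    refine (hy' h hh).trans ((add_le_add_right (einf_sub_le_of_lipSemiE_lt_top hlt hh) _).trans ?_)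
    rw [← ENNReal.ofReal_add (by positivity) (mul_nonneg hhq.le (lipSemi_nonneg _ _))]
    refine ENNReal.ofReal_le_ofReal ?_
    rw [mul_add (h ^ (1/q))]
    refine add_le_add ?_ (mul_le_mul_of_nonneg_left hy'le hhq.le)
    have e1 : t ^ (1/p) = t ^ (1/q) * t ^ (1/p - 1/q) := by
      rw [← Real.rpow_add ht]
      ring_nf
    have e2 : t ^ (1/q) ≤ h ^ (1/q) := Real.rpow_le_rpow ht.le h1 hq0
    rw [e1, mul_left_comm]
    exact mul_le_mul_of_nonneg_right e2 (by positivity)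

end Auxiliary

/-- Let `1 ≤ p < q < ∞` and let `f` be measurable on `ℝ²` with
a.e. sections in `Lip (1/p)` and `φ_{p,1}, φ_{p,2} ∈ L^{p,1}(ℝ)`. Then
`φ_{q,1}, φ_{q,2} ∈ S₀(ℝ)` and for every `t > 0`,
`φ_{q,1}*(t) - φ_{q,1}*(2t) ≤ 4 [φ_{p,1}*(t) + 2 φ_{p,2}*(t/2)] t^{1/p - 1/q}`. -/
theorem stmt16 (p q : ℝ) (hp : 1 ≤ p) (hpq : p < q) (f : ℝ × ℝ → ℝ)
    (hf : Measurable f)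
    (hy : ∀ᵐ y : ℝ ∂volume, MemLip (1/p) (fun x => f (x, y)))
    (hx : ∀ᵐ x : ℝ ∂volume, MemLip (1/p) (fun y => f (x, y)))
    (hL1 : MemLorentz p 1 (fun y => lipSemi (1/p) (fun x => f (x, y))))
    (hL2 : MemLorentz p 1 (fun x => lipSemi (1/p) (fun y => f (x, y)))) :
    S0 (fun y => lipSemi (1/q) (fun x => f (x, y))) ∧
    S0 (fun x => lipSemi (1/q) (fun y => f (x, y))) ∧
    ∀ t : ℝ, 0 < t →
      rearr (fun y => lipSemi (1/q) (fun x => f (x, y))) t -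
          rearr (fun y => lipSemi (1/q) (fun x => f (x, y))) (2 * t) ≤
        4 * (rearr (fun y => lipSemi (1/p) (fun x => f (x, y))) t +
              2 * rearr (fun x => lipSemi (1/p) (fun y => f (x, y))) (t / 2)) *
          t ^ (1/p - 1/q) := by
  have hG := ae_goodLevel hf hy hx
  have hG' : ∀ᵐ x, GoodLevel (1/p) (fun z => f z.swap) x :=
    ae_goodLevel (hf.comp measurable_swap) hx hy
  have hS := S0_lipSemi_section hp hpq hf hG hL1 hL2
  refine ⟨hS, ?_, fun t ht => ?_⟩
  · exact S0_lipSemi_section hp hpq (f := fun z => f z.swap) (hf.comp measurable_swap) hG' hL2 hL1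
  · rw [sub_le_iff_le_add]
    exact rearr_lipSemi_section_le hp hpq hf hG hL1.1 hL2.1 hS ht

end
end

section
/- Let f ∈ W₁^{2,2}(ℝ²). Then ∫_ℝ ‖f_x‖*_{Lip 1} dx ≤ (1/2) ‖D₂²f‖_{L¹(ℝ²)} and ∫_ℝ ‖f_y‖*_{Lip 1} dy ≤ (1/2) ‖D₁²f‖_{L¹(ℝ²)}, where f_x(y) = f(x,y) and f_y(x) = f(x,y) denote the sections of f. -/
open MeasureTheory Set
open scoped ENNReal

noncomputable section

/-- `f ∈ W₁^{2,2}(ℝ²)` with pure second distributional derivatives `g₁ = D₁²f` and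
`g₂ = D₂²f`: all three are integrable and the integration-by-parts identities hold
against smooth compactly supported test functions. -/
def IsW122 (f g₁ g₂ : ℝ × ℝ → ℝ) : Prop :=
  Integrable f volume ∧ Integrable g₁ volume ∧ Integrable g₂ volume ∧
  (∀ φ : ℝ × ℝ → ℝ, ContDiff ℝ (⊤ : ℕ∞) φ → HasCompactSupport φ →
    ∫ z : ℝ × ℝ, f z * deriv (fun x => deriv (fun x' => φ (x', z.2)) x) z.1 =
      ∫ z : ℝ × ℝ, g₁ z * φ z) ∧
  (∀ φ : ℝ × ℝ → ℝ, ContDiff ℝ (⊤ : ℕ∞) φ → HasCompactSupport φ →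
    ∫ z : ℝ × ℝ, f z * deriv (fun y => deriv (fun y' => φ (z.1, y')) y) z.2 =
      ∫ z : ℝ × ℝ, g₂ z * φ z)

/-- `g` is the weak second derivative of `f` in the second variable. -/
def IsWeakSecondDerivSnd (f g : ℝ × ℝ → ℝ) : Prop :=
  ∀ φ : ℝ × ℝ → ℝ, ContDiff ℝ (⊤ : ℕ∞) φ → HasCompactSupport φ →
    ∫ z : ℝ × ℝ, f z * deriv (fun y => deriv (fun y' => φ (z.1, y')) y) z.2 =
      ∫ z : ℝ × ℝ, g z * φ z

/-- The second antiderivative of `ψ (· - h) - ψ` that is symmetric about zero is bounded by `h / 2`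
when `ψ` is a smooth probability density. -/
lemma exists_bounded_second_antideriv {ψ : ℝ → ℝ} (hψ : ContDiff ℝ (⊤ : ℕ∞) ψ)
    (hs : HasCompactSupport ψ) (h0 : ∀ t, 0 ≤ ψ t) (h1 : ∫ t, ψ t = 1) {h : ℝ} (hh : 0 < h) :
    ∃ u u₁ : ℝ → ℝ, ContDiff ℝ (⊤ : ℕ∞) u ∧ (∀ t, HasDerivAt u (u₁ t) t) ∧
      (∀ t, HasDerivAt u₁ (ψ (t - h) - ψ t) t) ∧ (∀ t, |u t| ≤ h / 2) ∧ ∀ t, |u₁ t| ≤ 1 := by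
  have hi : Integrable ψ := hψ.continuous.integrable_of_hasCompactSupport hs
  set A : ℝ → ℝ := fun t => ∫ s in Iic t, ψ s with hA
  have hA0 : ∀ t, 0 ≤ A t := fun t => setIntegral_nonneg measurableSet_Iic fun s _ => h0 s
  have hA1 : ∀ t, A t ≤ 1 := fun t =>
    h1 ▸ setIntegral_le_integral hi (Filter.Eventually.of_forall h0)
  have hAe : ∀ t, A t = A 0 + ∫ s in (0 : ℝ)..t, ψ s := fun t => by
    rw [← intervalIntegral.integral_Iic_sub_Iic hi.integrableOn hi.integrableOn]
    simp [hA]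
  have hAd : ∀ t, HasDerivAt A (ψ t) t := fun t => by
    rw [funext hAe]
    exact (hψ.continuous.integral_hasStrictDerivAt 0 t).hasDerivAt.const_add _
  have hAs : ContDiff ℝ (⊤ : ℕ∞) A := by
    rw [contDiff_infty_iff_deriv]
    exact ⟨fun t => (hAd t).differentiableAt, by rwa [funext fun t => (hAd t).deriv]⟩
  set B : ℝ → ℝ := fun t => ∫ s in (0 : ℝ)..t, A s
  have hBd : ∀ t, HasDerivAt B (A t) t := fun t =>
    (hAs.continuous.integral_hasStrictDerivAt 0 t).hasDerivAt
  have hBs : ContDiff ℝ (⊤ : ℕ∞) B := by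
    rw [contDiff_infty_iff_deriv]
    exact ⟨fun t => (hBd t).differentiableAt, by rwa [funext fun t => (hBd t).deriv]⟩
  have hAi : ∀ a b, IntervalIntegrable A volume a b := fun a b =>
    hAs.continuous.intervalIntegrable a b
  refine ⟨fun t => h / 2 - (B t - B (t - h)), fun t => -(A t - A (t - h)), ?_, ?_, ?_, ?_, ?_⟩
  · fun_prop
  · intro t
    have := ((hBd t).sub ((hBd (t - h)).comp_sub_const t h)).const_sub (h / 2)
    exact this
  · intro t
    have := ((hAd t).sub ((hAd (t - h)).comp_sub_const t h)).neg
    convert! this using 1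
    ring
  · intro t
    have e : B t - B (t - h) = ∫ s in (t - h)..t, A s :=
      intervalIntegral.integral_interval_sub_left (hAi _ _) (hAi _ _)
    have l : 0 ≤ ∫ s in (t - h)..t, A s :=
      intervalIntegral.integral_nonneg (by linarith) fun s _ => hA0 s
    have r : ∫ s in (t - h)..t, A s ≤ ∫ s in (t - h)..t, (1 : ℝ) :=
      intervalIntegral.integral_mono_on (by linarith) (hAi _ _) (by simp) fun s _ => hA1 s
    simp only [intervalIntegral.integral_const, smul_eq_mul, mul_one, sub_sub_cancel] at r
    simp only [abs_le, e]
    constructor <;> linarith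
  · intro t
    rw [abs_le]
    constructor <;> linarith [hA0 t, hA1 t, hA0 (t - h), hA1 (t - h)]

/-- The weak second derivative identity extends from compactly supported test functions to products
whose second factor is merely bounded together with its first two derivatives. -/
lemma IsWeakSecondDerivSnd.integral_mul_of_bounded {f g : ℝ × ℝ → ℝ}
    (H : IsWeakSecondDerivSnd f g) (hf : Integrable f) (hg : Integrable g)
    {η u u₁ u₂ : ℝ → ℝ} (hη : ContDiff ℝ (⊤ : ℕ∞) η) (hηs : HasCompactSupport η)
    (hu : ContDiff ℝ (⊤ : ℕ∞) u) (hu₁ : ∀ t, HasDerivAt u (u₁ t) t)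
    (hu₂ : ∀ t, HasDerivAt u₁ (u₂ t) t) {C : ℝ} (bu : ∀ t, |u t| ≤ C) (bu₁ : ∀ t, |u₁ t| ≤ C)
    (bu₂ : ∀ t, |u₂ t| ≤ C) :
    ∫ z : ℝ × ℝ, f z * (η z.1 * u₂ z.2) = ∫ z : ℝ × ℝ, g z * (η z.1 * u z.2) := by
  obtain ⟨b⟩ : Nonempty (ContDiffBump (0 : ℝ)) := inferInstance
  set χ : ℝ → ℝ := ⇑b
  have χs : ContDiff ℝ (⊤ : ℕ∞) χ := b.contDiff
  have χs₁ : ContDiff ℝ (⊤ : ℕ∞) (deriv χ) := (contDiff_infty_iff_deriv.1 χs).2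
  have χs₂ : ContDiff ℝ (⊤ : ℕ∞) (deriv (deriv χ)) := (contDiff_infty_iff_deriv.1 χs₁).2
  have χc : HasCompactSupport χ := b.hasCompactSupport
  obtain ⟨K₀, hK₀⟩ := χs.continuous.bounded_above_of_compact_support χc
  obtain ⟨K₁, hK₁⟩ := χs₁.continuous.bounded_above_of_compact_support χc.deriv
  obtain ⟨K₂, hK₂⟩ := χs₂.continuous.bounded_above_of_compact_support χc.deriv.deriv
  obtain ⟨L, hL⟩ := hη.continuous.bounded_above_of_compact_support hηs
  simp only [Real.norm_eq_abs] at hK₀ hK₁ hK₂ hL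
  have hC : 0 ≤ C := (abs_nonneg _).trans (bu 0)
  have χ0 : χ 0 = 1 := b.one_of_mem_closedBall (by simp [b.rIn_pos.le])
  have uc : Continuous u := hu.continuous
  have uc₁ : Continuous u₁ := continuous_iff_continuousAt.2 fun t => (hu₂ t).continuousAt
  have uc₂ : Continuous u₂ := by
    have e₁ : deriv u = u₁ := funext fun t => (hu₁ t).deriv
    have e₂ : deriv u₁ = u₂ := funext fun t => (hu₂ t).deriv
    rw [← e₂, ← e₁]
    exact (contDiff_infty_iff_deriv.1 (contDiff_infty_iff_deriv.1 hu).2).2.continuous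
  set c : ℕ → ℝ := fun n => 1 / ((n : ℝ) + 1) with hc
  have c0 : ∀ n, 0 < c n := fun n => Nat.one_div_pos_of_nat
  have c1 : ∀ n, c n ≤ 1 := fun n => by
    have : (0 : ℝ) ≤ n := n.cast_nonneg
    rw [hc]
    exact (div_le_one (by linarith)).2 (by linarith)
  have ct : Filter.Tendsto c Filter.atTop (nhds 0) := tendsto_one_div_add_atTop_nhds_zero_nat
  set w : ℝ → ℝ → ℝ := fun a t => a ^ 2 * deriv (deriv χ) (a * t) * u t
    + 2 * a * deriv χ (a * t) * u₁ t + χ (a * t) * u₂ t with hw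
  have key : ∀ n, ∫ z : ℝ × ℝ, f z * (η z.1 * w (c n) z.2)
      = ∫ z : ℝ × ℝ, g z * (η z.1 * (χ (c n * z.2) * u z.2)) := fun n => by
    have hcs : HasCompactSupport fun z : ℝ × ℝ => η z.1 * (χ (c n * z.2) * u z.2) := by
      have hχn : HasCompactSupport fun t => χ (c n * t) * u t :=
        (χc.comp_homeomorph (Homeomorph.mulLeft₀ (c n) (c0 n).ne')).mul_right
      refine HasCompactSupport.intro (hηs.prod hχn) fun z hz => ?_
      by_contra hne
      exact hz ⟨subset_tsupport _ (left_ne_zero_of_mul hne),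
        subset_tsupport _ (right_ne_zero_of_mul hne)⟩
    rw [← H (fun z => η z.1 * (χ (c n * z.2) * u z.2)) (by fun_prop) hcs]
    congr 1
    ext z
    congr 1
    have dχ : ∀ t, HasDerivAt (fun t => χ (c n * t)) (c n * deriv χ (c n * t)) t := fun t => by
      have := ((χs.differentiable (by simp)) (c n * t)).hasDerivAt.comp t
        ((hasDerivAt_id t).const_mul (c n))
      convert! this using 1
      simp [mul_comm]
    have dχ₁ : ∀ t, HasDerivAt (fun t => deriv χ (c n * t))
        (c n * deriv (deriv χ) (c n * t)) t := fun t => by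
      have := ((χs₁.differentiable (by simp)) (c n * t)).hasDerivAt.comp t
        ((hasDerivAt_id t).const_mul (c n))
      convert! this using 1
      simp [mul_comm]
    have d₁ : ∀ t, deriv (fun t => η z.1 * (χ (c n * t) * u t)) t
        = η z.1 * (c n * deriv χ (c n * t) * u t + χ (c n * t) * u₁ t) := fun t =>
      (((dχ t).mul (hu₁ t)).const_mul _).deriv
    have d₂ := (((((dχ₁ z.2).const_mul (c n)).mul (hu₁ z.2)).add
      ((dχ z.2).mul (hu₂ z.2))).const_mul (η z.1)).deriv
    simp only [d₁]
    refine Eq.trans ?_ d₂.symm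
    simp only [hw]
    ring
  refine tendsto_nhds_unique (f := fun n => ∫ z : ℝ × ℝ, f z * (η z.1 * w (c n) z.2))
    (l := Filter.atTop) ?_ ?_
  · refine tendsto_integral_of_dominated_convergence
      (fun z => |f z| * (L * (K₂ * C + 2 * K₁ * C + K₀ * C))) ?_ (hf.abs.mul_const _) ?_ ?_
    · intro n
      have : Continuous fun z : ℝ × ℝ => η z.1 * w (c n) z.2 := by
        have := hη.continuous
        have := χs.continuous
        have := χs₁.continuous
        have := χs₂.continuous
        simp only [hw]
        fun_prop
      exact hf.aestronglyMeasurable.mul this.aestronglyMeasurable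
    · intro n
      refine Filter.Eventually.of_forall fun z => ?_
      rw [Real.norm_eq_abs, abs_mul, abs_mul]
      have K₀0 := (abs_nonneg _).trans (hK₀ 0)
      have K₁0 := (abs_nonneg _).trans (hK₁ 0)
      have K₂0 := (abs_nonneg _).trans (hK₂ 0)
      have L0 := (abs_nonneg _).trans (hL 0)
      gcongr
      · exact hL _
      · simp only [hw]
        refine (abs_add_three _ _ _).trans ?_
        simp only [abs_mul, abs_pow, abs_of_pos (c0 n), abs_two]
        have s1 : c n ^ 2 ≤ 1 := pow_le_one₀ (c0 n).le (c1 n)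
        have t1 : c n ^ 2 * |deriv (deriv χ) (c n * z.2)| * |u z.2| ≤ 1 * K₂ * C := by
          gcongr
          · exact hK₂ _
          · exact bu _
        have t2 : 2 * c n * |deriv χ (c n * z.2)| * |u₁ z.2| ≤ 2 * 1 * K₁ * C := by
          gcongr
          · exact c1 n
          · exact hK₁ _
          · exact bu₁ _
        have t3 : |χ (c n * z.2)| * |u₂ z.2| ≤ K₀ * C := by
          gcongr
          · exact hK₀ _
          · exact bu₂ _
        linarith
    · refine Filter.Eventually.of_forall fun z => ?_
      have hwc : Continuous fun a => f z * (η z.1 * w a z.2) := by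
        have := χs.continuous
        have := χs₁.continuous
        have := χs₂.continuous
        simp only [hw]
        fun_prop
      have := (hwc.tendsto 0).comp ct
      simpa [hw, χ0, Function.comp_def] using this
  · simp only [key]
    refine tendsto_integral_of_dominated_convergence
      (fun z => |g z| * (L * (K₀ * C))) ?_ (hg.abs.mul_const _) ?_ ?_
    · intro n
      have : Continuous fun z : ℝ × ℝ => η z.1 * (χ (c n * z.2) * u z.2) := by
        have := hη.continuous
        have := χs.continuous
        fun_prop
      exact hg.aestronglyMeasurable.mul this.aestronglyMeasurable
    · intro n
      refine Filter.Eventually.of_forall fun z => ?_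
      rw [Real.norm_eq_abs, abs_mul, abs_mul, abs_mul]
      have K₀0 := (abs_nonneg _).trans (hK₀ 0)
      have L0 := (abs_nonneg _).trans (hL 0)
      gcongr
      · exact hL _
      · exact hK₀ _
      · exact bu _
    · refine Filter.Eventually.of_forall fun z => ?_
      have hwc : Continuous fun a => g z * (η z.1 * (χ (a * z.2) * u z.2)) := by
        have := χs.continuous
        fun_prop
      have := (hwc.tendsto 0).comp ct
      simpa [χ0, Function.comp_def] using this

/-- Almost every section of `f`, averaged against a smooth probability density and its translate by
`h`, changes by at most `h / 2` times the `L¹` norm of the section of `g`. -/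
lemma IsWeakSecondDerivSnd.ae_abs_integral_translate_sub_le {f g : ℝ × ℝ → ℝ}
    (H : IsWeakSecondDerivSnd f g) (hf : Integrable f) (hg : Integrable g)
    {ψ : ℝ → ℝ} (hψ : ContDiff ℝ (⊤ : ℕ∞) ψ)
    (hs : HasCompactSupport ψ) (h0 : ∀ t, 0 ≤ ψ t) (h1 : ∫ t, ψ t = 1) {h : ℝ} (hh : 0 < h) :
    ∀ᵐ x : ℝ, |∫ t, f (x, t) * (ψ (t - h) - ψ t)| ≤ h / 2 * ∫ t, |g (x, t)| := by
  obtain ⟨u, u₁, hu, hu₁, hu₂, bu, bu₁⟩ := exists_bounded_second_antideriv hψ hs h0 h1 hh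
  obtain ⟨K, hK⟩ := hψ.continuous.bounded_above_of_compact_support hs
  have bu₂ : ∀ t, |ψ (t - h) - ψ t| ≤ K + K := fun t =>
    (abs_sub _ _).trans (add_le_add (hK _) (hK _))
  have hf1 : Integrable fun z : ℝ × ℝ => f z * (ψ (z.2 - h) - ψ z.2) := by
    refine hf.mul_bdd (c := K + K) ?_ (Filter.Eventually.of_forall fun z => bu₂ z.2)
    have := hψ.continuous
    exact Continuous.aestronglyMeasurable (by fun_prop)
  have hg1 : Integrable fun z : ℝ × ℝ => g z * u z.2 := by
    refine hg.mul_bdd (c := h / 2) ?_ (Filter.Eventually.of_forall fun z => bu z.2)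
    have := hu.continuous
    exact Continuous.aestronglyMeasurable (by fun_prop)
  have hG : Integrable fun z : ℝ × ℝ => f z * (ψ (z.2 - h) - ψ z.2) - g z * u z.2 := hf1.sub hg1
  have hF := hG.integral_prod_left
  have hF0 := ae_eq_zero_of_integral_contDiff_smul_eq_zero hF.locallyIntegrable
    fun η hη hηs => by
      obtain ⟨L, hL⟩ := hη.continuous.bounded_above_of_compact_support hηs
      have hηm : AEStronglyMeasurable (fun z : ℝ × ℝ => η z.1) volume := by
        have := hη.continuous
        exact Continuous.aestronglyMeasurable (by fun_prop)
      have hηb : ∀ᵐ z : ℝ × ℝ, ‖η z.1‖ ≤ L := Filter.Eventually.of_forall fun z => hL z.1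
      have E := H.integral_mul_of_bounded hf hg hη hηs hu hu₁ hu₂
        (C := max (h / 2) (max 1 (K + K))) (fun t => (bu t).trans (le_max_left _ _))
        (fun t => (bu₁ t).trans ((le_max_left _ _).trans (le_max_right _ _)))
        (fun t => (bu₂ t).trans ((le_max_right _ _).trans (le_max_right _ _)))
      have I : ∫ z : ℝ × ℝ, η z.1 * (f z * (ψ (z.2 - h) - ψ z.2) - g z * u z.2) = 0 := by
        simp only [mul_sub (η _)]
        rw [integral_sub (hf1.bdd_mul (c := L) hηm hηb) (hg1.bdd_mul (c := L) hηm hηb), sub_eq_zero]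
        simpa only [mul_left_comm] using E
      rw [Measure.volume_eq_prod, integral_prod _ (hG.bdd_mul (c := L) hηm hηb)] at I
      simpa only [integral_const_mul, smul_eq_mul] using! I
  filter_upwards [hF0, hf1.prod_right_ae, hg1.prod_right_ae, hg.prod_right_ae]
    with x hx hx1 hx2 hx3
  have e : ∫ t, f (x, t) * (ψ (t - h) - ψ t) = ∫ t, g (x, t) * u t := by
    rw [← sub_eq_zero, ← integral_sub hx1 hx2]
    exact hx
  rw [e, ← integral_const_mul]
  refine (abs_integral_le_integral_abs).trans (integral_mono hx2.abs (hx3.abs.const_mul _) ?_)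
  intro t
  simp only [abs_mul]
  rw [mul_comm]
  gcongr
  exact bu t

/-- A function that is an almost everywhere limit of `C`-Lipschitz functions has Lipschitz seminorm
at most `C`. -/
lemma lipSemiE_one_le_of_ae_tendsto {φ : ℝ → ℝ} {M : ℕ → ℝ → ℝ} {C : ℝ}
    (hM : ∀ n a b, |M n b - M n a| ≤ C * |b - a|)
    (hφ : ∀ᵐ y, Filter.Tendsto (fun n => M n y) Filter.atTop (nhds (φ y))) :
    lipSemiE 1 φ ≤ ENNReal.ofReal C := by
  refine iSup₂_le fun h hh => ?_
  have hh : 0 < h := hh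
  have hb : einf (fun x => φ (x + h) - φ x) ≤ ENNReal.ofReal (C * h) := by
    rw [einf, eLpNorm_exponent_top]
    refine eLpNormEssSup_le_of_ae_bound ?_
    have hφ' := (quasiMeasurePreserving_add_right volume h).ae hφ
    filter_upwards [hφ, hφ'] with y hy hy'
    refine le_of_tendsto (hy'.sub hy).norm (Filter.Eventually.of_forall fun n => ?_)
    simpa [abs_of_pos hh] using hM n y (y + h)
  calc _ ≤ ENNReal.ofReal (h ^ (-1 : ℝ)) * ENNReal.ofReal (C * h) := by gcongr
    _ = ENNReal.ofReal C := by
      rw [← ENNReal.ofReal_mul (by positivity), Real.rpow_neg_one]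
      congr 1
      field_simp

/-- Almost every section of `f` is Lipschitz with constant half the `L¹` norm of the section of its
second derivative. -/
lemma IsWeakSecondDerivSnd.ae_lipSemiE_le {f g : ℝ × ℝ → ℝ}
    (H : IsWeakSecondDerivSnd f g) (hf : Integrable f) (hg : Integrable g) :
    ∀ᵐ x : ℝ, lipSemiE 1 (fun y => f (x, y)) ≤ ENNReal.ofReal (1 / 2 * ∫ t, |g (x, t)|) := by
  let b : ℕ → ContDiffBump (0 : ℝ) := fun n =>
    ⟨1 / ((n : ℝ) + 1), 2 * (1 / ((n : ℝ) + 1)), Nat.one_div_pos_of_nat,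
      lt_two_mul_self Nat.one_div_pos_of_nat⟩
  have hbt : Filter.Tendsto (fun n => (b n).rOut) Filter.atTop (nhds 0) := by
    simpa only [mul_zero] using! (tendsto_one_div_add_atTop_nhds_zero_nat (𝕜 := ℝ)).const_mul 2
  let ρ : ℕ → ℝ → ℝ := fun n => (b n).normed volume
  have ρc : ∀ n, HasCompactSupport (ρ n) := fun n => (b n).hasCompactSupport_normed
  have ρs : ∀ n, ContDiff ℝ (⊤ : ℕ∞) (ρ n) := fun n => (b n).contDiff_normed
  have hall : ∀ᵐ x : ℝ, ∀ (n : ℕ) (q r : ℚ), (0 : ℝ) < r →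
      |∫ t, f (x, t) * (ρ n (t - r - q) - ρ n (t - q))| ≤ r / 2 * ∫ t, |g (x, t)| := by
    refine ae_all_iff.2 fun n => ae_all_iff.2 fun q => ae_all_iff.2 fun r => ?_
    by_cases hr : (0 : ℝ) < r
    · have hc : HasCompactSupport fun t => ρ n (t - q) :=
        (ρc n).comp_homeomorph (Homeomorph.subRight (q : ℝ))
      have := H.ae_abs_integral_translate_sub_le hf hg (ψ := fun t => ρ n (t - q))
        ((ρs n).comp (contDiff_id.sub contDiff_const)) hc (fun t => (b n).nonneg_normed _)
        (by rw [integral_sub_right_eq_self (ρ n)]; exact (b n).integral_normed) hr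
      filter_upwards [this] with x hx _ using hx
    · exact Filter.Eventually.of_forall fun x h => absurd h hr
  filter_upwards [hall, hf.prod_right_ae] with x hx hfx
  have hfl : LocallyIntegrable (fun t => f (x, t)) := hfx.locallyIntegrable
  let M : ℕ → ℝ → ℝ := fun n =>
    convolution (ρ n) (fun t => f (x, t)) (ContinuousLinearMap.lsmul ℝ ℝ) volume
  have hMc : ∀ n, Continuous (M n) := fun n =>
    (ρc n).continuous_convolution_left _ (ρs n).continuous hfl
  have hMe : ∀ n y, M n y = ∫ t, f (x, t) * ρ n (t - y) := fun n y => by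
    simp only [M]
    rw [convolution_lsmul_swap]
    congr 1
    ext t
    have : ρ n (y - t) = ρ n (t - y) := by rw [← neg_sub]; exact (b n).normed_neg _
    rw [smul_eq_mul, mul_comm, this]
  have hMi : ∀ n y, Integrable fun t => f (x, t) * ρ n (t - y) := fun n y => by
    obtain ⟨K, hK⟩ := (ρs n).continuous.bounded_above_of_compact_support (ρc n)
    refine hfx.mul_bdd (c := K) ?_ (Filter.Eventually.of_forall fun t => hK _)
    have := (ρs n).continuous
    exact Continuous.aestronglyMeasurable (by fun_prop)
  set C := 1 / 2 * ∫ t, |g (x, t)| with hC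
  have hlt : ∀ (n : ℕ) (q r : ℚ), q < r → |M n r - M n q| ≤ C * |(r : ℝ) - q| := by
    intro n q r hqr
    have hpos : (0 : ℝ) < (r : ℝ) - q := sub_pos.2 (by exact_mod_cast hqr)
    have := hx n q (r - q) (by push_cast; exact hpos)
    rw [hMe, hMe, ← integral_sub (hMi n r) (hMi n q), abs_of_pos hpos]
    push_cast at this
    simp only [← mul_sub]
    simp only [sub_sub, sub_add_cancel] at this
    refine this.trans (le_of_eq ?_)
    rw [hC]
    ring
  have hM : ∀ n a c, |M n c - M n a| ≤ C * |c - a| := fun n a c => by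
    have hd : DenseRange (Prod.map ((↑) : ℚ → ℝ) ((↑) : ℚ → ℝ)) :=
      Rat.denseRange_cast.prodMap Rat.denseRange_cast
    refine hd.induction_on (p := fun z : ℝ × ℝ => |M n z.2 - M n z.1| ≤ C * |z.2 - z.1|) (a, c)
      (isClosed_le ?_ ?_) ?_
    · have := hMc n
      fun_prop
    · fun_prop
    · rintro ⟨q, r⟩
      rcases lt_trichotomy q r with h | rfl | h
      · exact hlt n q r h
      · simp
      · simp only [Prod.map_apply]
        rw [abs_sub_comm, abs_sub_comm (r : ℝ)]
        exact hlt n r q h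
  exact lipSemiE_one_le_of_ae_tendsto hM
    (ContDiffBump.ae_convolution_tendsto_right_of_locallyIntegrable (K := 2) hbt
      (Filter.Eventually.of_forall fun n => le_rfl) hfl)

lemma IsWeakSecondDerivSnd.lintegral_lipSemiE_le {f g : ℝ × ℝ → ℝ}
    (H : IsWeakSecondDerivSnd f g) (hf : Integrable f) (hg : Integrable g) :
    ∫⁻ x : ℝ, lipSemiE 1 (fun y => f (x, y)) ≤
      ENNReal.ofReal ((1/2) * ∫ z : ℝ × ℝ, |g z|) := by
  have hi : Integrable fun x => ∫ t, |g (x, t)| := hg.abs.integral_prod_left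
  refine (lintegral_mono_ae (H.ae_lipSemiE_le hf hg)).trans (le_of_eq ?_)
  rw [← ofReal_integral_eq_lintegral_ofReal (hi.const_mul _)
    (Filter.Eventually.of_forall fun x => by positivity), integral_const_mul,
    Measure.volume_eq_prod, integral_prod _ hg.abs]

/-- A weak second derivative in the first variable becomes one in the second variable after
swapping the variables. -/
lemma IsWeakSecondDerivSnd.of_swap {f g : ℝ × ℝ → ℝ}
    (H : ∀ φ : ℝ × ℝ → ℝ, ContDiff ℝ (⊤ : ℕ∞) φ → HasCompactSupport φ →
      ∫ z : ℝ × ℝ, f z * deriv (fun x => deriv (fun x' => φ (x', z.2)) x) z.1 =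
        ∫ z : ℝ × ℝ, g z * φ z) :
    IsWeakSecondDerivSnd (f ∘ Prod.swap) (g ∘ Prod.swap) := by
  intro φ hφ hs
  have e := H (φ ∘ Prod.swap) (hφ.comp (contDiff_snd.prodMk contDiff_fst))
    (hs.comp_homeomorph (Homeomorph.prodComm ℝ ℝ))
  rw [Measure.volume_eq_prod] at e ⊢
  rw [← integral_prod_swap, ← integral_prod_swap (fun z => g z * _)] at e
  exact e

/-- For `f ∈ W₁^{2,2}(ℝ²)`,
`∫_ℝ ‖f_x‖*_{Lip 1} dx ≤ (1/2) ‖D₂²f‖₁` and `∫_ℝ ‖f_y‖*_{Lip 1} dy ≤ (1/2) ‖D₁²f‖₁`. -/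
theorem stmt18 (f g₁ g₂ : ℝ × ℝ → ℝ) (hf : IsW122 f g₁ g₂) :
    (∫⁻ x : ℝ, lipSemiE 1 (fun y => f (x, y)) ≤
      ENNReal.ofReal ((1/2) * ∫ z : ℝ × ℝ, |g₂ z|)) ∧
    (∫⁻ y : ℝ, lipSemiE 1 (fun x => f (x, y)) ≤
      ENNReal.ofReal ((1/2) * ∫ z : ℝ × ℝ, |g₁ z|)) := by
  obtain ⟨hf, hg₁, hg₂, h₁, h₂⟩ := hf
  refine ⟨IsWeakSecondDerivSnd.lintegral_lipSemiE_le h₂ hf hg₂, ?_⟩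
  have e : ∫ z : ℝ × ℝ, |g₁ z| = ∫ z : ℝ × ℝ, |(g₁ ∘ Prod.swap) z| := by
    rw [Measure.volume_eq_prod]
    exact (integral_prod_swap fun z => |g₁ z|).symm
  rw [e]
  exact (IsWeakSecondDerivSnd.of_swap h₁).lintegral_lipSemiE_le hf.swap hg₁.swap

end
end
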